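/- Let X, Y, Z be objects of T. Suppose Z is Y-complete and Y lies in every thick class containing X. Then Z is X-complete. (This is the triangulated content of the paper's Corollary asserting that if k lies in the thick subcategory generated by a compact module W and R is k-complete, then R is W-complete.) -/

import Mathlib

open CategoryTheory CategoryTheory.Limits CategoryTheory.Pretriangulated

universe v u

variable (T : Type u) [Category.{v} T] [Preadditive T] [HasZeroObject T]
  [HasShift T ℤ] [∀ n : ℤ, (shiftFunctor T n).Additive] [Pretriangulated T]
  [HasCoproducts.{v} T]

/-- A class of objects of a pretriangulated category is *localizing* if it contains the
zero objects, is closed under isomorphisms, closed under shifts in both directions,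
closed under extensions (two-out-of-three for distinguished triangles), closed under
retracts, and closed under arbitrary small coproducts. -/
structure IsLocalizingClass (S : Set T) : Prop where
  zero_mem : ∀ Z : T, IsZero Z → Z ∈ S
  iso_mem : ∀ ⦃X Y : T⦄, (X ≅ Y) → X ∈ S → Y ∈ S
  shift_mem : ∀ (X : T) (n : ℤ), X ∈ S → (X⟦n⟧ : T) ∈ S
  ext₃ : ∀ (Tr : Triangle T), (Tr ∈ distTriang T) → Tr.obj₁ ∈ S → Tr.obj₂ ∈ S → Tr.obj₃ ∈ S
  ext₂ : ∀ (Tr : Triangle T), (Tr ∈ distTriang T) → Tr.obj₁ ∈ S → Tr.obj₃ ∈ S → Tr.obj₂ ∈ S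
  ext₁ : ∀ (Tr : Triangle T), (Tr ∈ distTriang T) → Tr.obj₂ ∈ S → Tr.obj₃ ∈ S → Tr.obj₁ ∈ S
  retract_mem : ∀ ⦃X Y : T⦄ (i : X ⟶ Y) (r : Y ⟶ X), i ≫ r = 𝟙 X → Y ∈ S → X ∈ S
  coprod_mem : ∀ ⦃ι : Type v⦄ (f : ι → T), (∀ i, f i ∈ S) → (∐ f) ∈ S

/-- `X` *builds* `Y` if `Y` belongs to every localizing class containing `X`. -/
def Builds (X Y : T) : Prop :=
  ∀ S : Set T, IsLocalizingClass T S → X ∈ S → Y ∈ S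

/-- An object `N` is `W`-*null* if every morphism `W⟦n⟧ ⟶ N` is zero, for every integer `n`. -/
def IsNull (W N : T) : Prop :=
  ∀ (n : ℤ) (f : (W⟦n⟧ : T) ⟶ N), f = 0

/-- A class of objects of a pretriangulated category is *thick* if it contains the
zero objects, is closed under isomorphisms, closed under shifts in both directions,
closed under extensions (two-out-of-three for distinguished triangles), and closed
under retracts. -/
structure IsThickClass (S : Set T) : Prop where
  zero_mem : ∀ Z : T, IsZero Z → Z ∈ S
  iso_mem : ∀ ⦃X Y : T⦄, (X ≅ Y) → X ∈ S → Y ∈ S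
  shift_mem : ∀ (X : T) (n : ℤ), X ∈ S → (X⟦n⟧ : T) ∈ S
  ext₃ : ∀ (Tr : Triangle T), (Tr ∈ distTriang T) → Tr.obj₁ ∈ S → Tr.obj₂ ∈ S → Tr.obj₃ ∈ S
  ext₂ : ∀ (Tr : Triangle T), (Tr ∈ distTriang T) → Tr.obj₁ ∈ S → Tr.obj₃ ∈ S → Tr.obj₂ ∈ S
  ext₁ : ∀ (Tr : Triangle T), (Tr ∈ distTriang T) → Tr.obj₂ ∈ S → Tr.obj₃ ∈ S → Tr.obj₁ ∈ S
  retract_mem : ∀ ⦃X Y : T⦄ (i : X ⟶ Y) (r : Y ⟶ X), i ≫ r = 𝟙 X → Y ∈ S → X ∈ S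

/-- An object `Z` is `W`-*complete* if every morphism `N⟦n⟧ ⟶ Z` is zero, for every
`W`-null object `N` and every integer `n`. -/
def IsCompleteWrt (W Z : T) : Prop :=
  ∀ N : T, IsNull T W N → ∀ (n : ℤ) (f : (N⟦n⟧ : T) ⟶ Z), f = 0

omit [HasZeroObject T] [∀ n : ℤ, (shiftFunctor T n).Additive] [Pretriangulated T]
  [HasCoproducts.{v} T] in
variable {T} in
theorem IsNull.of_retract {N X Y : T} (i : X ⟶ Y) (r : Y ⟶ X) (hir : i ≫ r = 𝟙 X)
    (hY : IsNull T Y N) : IsNull T X N := fun n f => by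
  have hid : i⟦n⟧' ≫ r⟦n⟧' = 𝟙 (X⟦n⟧) := by rw [← Functor.map_comp, hir, CategoryTheory.Functor.map_id]
  rw [← Category.id_comp f, ← hid, Category.assoc, hY n (r⟦n⟧' ≫ f), comp_zero]

omit [HasZeroObject T] [∀ n : ℤ, (shiftFunctor T n).Additive] [Pretriangulated T]
  [HasCoproducts.{v} T] in
variable {T} in
theorem IsNull.shift {N X : T} (hX : IsNull T X N) (m : ℤ) : IsNull T (X⟦m⟧) N := fun n f => by
  rw [← cancel_epi ((shiftFunctorAdd T m n).hom.app X), comp_zero]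
  exact hX (m + n) _

omit [HasCoproducts.{v} T] in
variable {T} in
theorem IsNull.ext₂ {N : T} (Tr : Triangle T) (hTr : Tr ∈ distTriang T)
    (h₁ : IsNull T Tr.obj₁ N) (h₃ : IsNull T Tr.obj₃ N) : IsNull T Tr.obj₂ N := fun n f => by
  obtain ⟨g, hg⟩ := Triangle.yoneda_exact₂ _ (Triangle.shift_distinguished Tr hTr n) f (h₁ n _)
  rw [hg, show g = 0 from h₃ n g]
  exact comp_zero

omit [HasCoproducts.{v} T] in
/-- The objects `W` for which `N` is `W`-null form a thick class. -/
theorem isThickClass_setOf_isNull (N : T) : IsThickClass T {W | IsNull T W N} where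
  zero_mem _ hZ n _ := ((shiftFunctor T n).map_isZero hZ).eq_of_src _ _
  iso_mem _ _ e hX := hX.of_retract e.inv e.hom e.inv_hom_id
  shift_mem _ n hX := hX.shift n
  ext₃ Tr hTr h₁ h₂ := IsNull.ext₂ Tr.rotate (rot_of_distTriang Tr hTr) h₂ (h₁.shift 1)
  ext₂ Tr hTr h₁ h₃ := IsNull.ext₂ Tr hTr h₁ h₃
  ext₁ Tr hTr h₂ h₃ := IsNull.ext₂ Tr.invRotate (inv_rot_of_distTriang Tr hTr) (h₃.shift (-1)) h₂
  retract_mem _ _ i r hir hY := hY.of_retract i r hir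

/-- If `Z` is `Y`-complete and `Y` lies in every thick class containing `X`,
then `Z` is `X`-complete. -/
theorem isCompleteWrt_of_mem_thick (X Y Z : T) (hZ : IsCompleteWrt T Y Z)
    (h : ∀ S : Set T, IsThickClass T S → X ∈ S → Y ∈ S) :
    IsCompleteWrt T X Z := by
  exact fun N hN => hZ N (h _ (isThickClass_setOf_isNull T N) hN)
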